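/- Consider the four linear inequalities in real variables σ, x, y, s: σ + x − y − s ≤ 1; σ − x − y + s ≤ 1; σ − x + y − s ≤ 1; σ + x + y + s ≤ 3. Then: (a) if σ = 1 and x, y ∈ {0,1}, a real number s ∈ [0,1] satisfies all four inequalities if and only if s = x + y − 2xy (that is, s equals the exclusive-or of x and y); and (b) if σ = 0, then every (x, y, s) ∈ [0,1]³ satisfies all four inequalities. In other words, this system has the controlled {x,y}-0/1 property with control variable σ, implementing the assignment s ← x xor y. -/

import Mathlib

/-- The four inequalities `σ + x - y - s ≤ 1`, `σ - x - y + s ≤ 1`,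
`σ - x + y - s ≤ 1`, `σ + x + y + s ≤ 3` have the controlled `{x,y}`-0/1 property with
control variable `σ`, implementing `s ← x xor y`:
(a) if `σ = 1` and `x, y ∈ {0,1}`, then `s ∈ [0,1]` satisfies all four inequalities iff
`s = x + y - 2xy`; (b) if `σ = 0`, every `(x,y,s) ∈ [0,1]³` satisfies all four. -/
theorem xor_gadget_controlled_x01 :
    (∀ σ x y s : ℝ, σ = 1 → (x = 0 ∨ x = 1) → (y = 0 ∨ y = 1) →
      s ∈ Set.Icc (0 : ℝ) 1 →
      ((σ + x - y - s ≤ 1 ∧ σ - x - y + s ≤ 1 ∧ σ - x + y - s ≤ 1 ∧ σ + x + y + s ≤ 3)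
        ↔ s = x + y - 2 * x * y)) ∧
    (∀ σ x y s : ℝ, σ = 0 → x ∈ Set.Icc (0 : ℝ) 1 → y ∈ Set.Icc (0 : ℝ) 1 →
      s ∈ Set.Icc (0 : ℝ) 1 →
      (σ + x - y - s ≤ 1 ∧ σ - x - y + s ≤ 1 ∧ σ - x + y - s ≤ 1 ∧ σ + x + y + s ≤ 3)) := by
  constructor
  · rintro σ x y s rfl (rfl | rfl) (rfl | rfl) ⟨hs0, hs1⟩ <;> constructor
    all_goals first
      | (rintro ⟨h1, h2, h3, h4⟩; linarith)
      | (intro h; refine ⟨?_, ?_, ?_, ?_⟩ <;> linarith)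
  · rintro σ x y s rfl ⟨hx0, hx1⟩ ⟨hy0, hy1⟩ ⟨hs0, hs1⟩
    refine ⟨?_, ?_, ?_, ?_⟩ <;> linarith
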